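/- Let (E,H,(·|·)) and (E,H',(·|·)') be two extended affine Lie algebra structures on the same Lie algebra E over a field k of characteristic 0, with cores E_c and E'_c respectively. Then E_c = E'_c. -/

import Mathlib

/-! Statement 5: the core of an EALA does not depend on the EALA structure. -/

section EALA

variable {k E : Type*} [Field k] [CharZero k] [LieRing E] [LieAlgebra k E]

/-- The weight space of the toral subalgebra `H` for the weight `α ∈ H*`:
`E_α = {e ∈ E : [h,e] = α(h)e for all h ∈ H}`. -/
def wtSpace (H : LieSubalgebra k E) (α : Module.Dual k H) : Submodule k E where
  carrier := {e | ∀ h : H, ⁅(h : E), e⁆ = α h • e}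
  add_mem' := by
    intro a b ha hb h
    simp only [lie_add, ha h, hb h, smul_add]
  zero_mem' := by
    intro h
    simp
  smul_mem' := by
    intro c a ha h
    rw [lie_smul, ha h, smul_comm]

/-- The set of roots `Ψ` of `(E,H)`: those `α ∈ H*` with `E_α ≠ 0` (note `0 ∈ Ψ`). -/
def rootSet (H : LieSubalgebra k E) : Set (Module.Dual k H) :=
  {α | wtSpace H α ≠ ⊥}

variable (B : E →ₗ[k] E →ₗ[k] k)

/-- The representatives `t_α ∈ H` of `α ∈ H*` under the form: `(t_α | h) = α(h)` for `h ∈ H`. -/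
def reps (H : LieSubalgebra k E) (α : Module.Dual k H) : Set H :=
  {t | ∀ h : H, B (t : E) (h : E) = α h}

/-- The anisotropic roots: `Ψ^an = {α ∈ Ψ : (α|α) ≠ 0}`. -/
def anisoRootSet (H : LieSubalgebra k E) : Set (Module.Dual k H) :=
  {α | α ∈ rootSet H ∧ ∃ t ∈ reps B H α, B (t : E) (t : E) ≠ 0}

/-- The isotropic (null) roots: `Ψ⁰ = {α ∈ Ψ : (α|α) = 0}`. -/
def isoRootSet (H : LieSubalgebra k E) : Set (Module.Dual k H) :=
  {α | α ∈ rootSet H ∧ ∃ t ∈ reps B H α, B (t : E) (t : E) = 0}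

/-- The core `E_c` of `(E, H, (·|·))`: the subalgebra of `E` generated by
`⋃_{α ∈ Ψ^an} E_α`. -/
def core (H : LieSubalgebra k E) : LieSubalgebra k E :=
  LieSubalgebra.lieSpan k E (⋃ α ∈ anisoRootSet B H, (wtSpace H α : Set E))

/-- An extended affine Lie algebra structure `(E, H, (·|·))` (paper §2.3):
axioms (EA1)–(EA5), together with the requirements that the bilinear form is
nondegenerate, symmetric and invariant. -/
structure IsEALA (H : LieSubalgebra k E) : Prop where
  /-- the form is symmetric -/
  symm : ∀ x y : E, B x y = B y x
  /-- the form is invariant -/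
  invariant : ∀ x y z : E, B ⁅x, y⁆ z = B x ⁅y, z⁆
  /-- the form is nondegenerate -/
  nondeg : ∀ x : E, (∀ y : E, B x y = 0) → x = 0
  /-- (EA1): `H` is nontrivial … -/
  H_ne_bot : H ≠ ⊥
  /-- … finite-dimensional … -/
  H_fd : FiniteDimensional k H
  /-- … self-centralizing (in particular abelian): `E_0 = H` … -/
  self_centralizing : wtSpace H 0 = H.toSubmodule
  /-- … and toral: `E = ⊕_{α ∈ H*} E_α` -/
  toral : (⨆ α : Module.Dual k H, wtSpace H α) = ⊤
  /-- the restriction of the form to `H × H` is nondegenerate -/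
  H_nondeg : ∀ t : H, (∀ h : H, B (t : E) (h : E) = 0) → t = 0
  /-- (EA2): `ad x` is locally nilpotent for `x ∈ E_α`, `α ∈ Ψ^an` -/
  ea2 : ∀ α ∈ anisoRootSet B H, ∀ x ∈ wtSpace H α, ∀ e : E,
    ∃ N : ℕ, (fun y => ⁅x, y⁆)^[N] e = 0
  /-- (EA3): `Ψ^an` is connected -/
  ea3 : ∀ Ψ₁ Ψ₂ : Set (Module.Dual k H), anisoRootSet B H = Ψ₁ ∪ Ψ₂ →
    Ψ₁.Nonempty → Ψ₂.Nonempty →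
    ∃ α ∈ Ψ₁, ∃ β ∈ Ψ₂, ∃ t ∈ reps B H α, ∃ s ∈ reps B H β, B (t : E) (s : E) ≠ 0
  /-- (EA4): the centralizer of the core is contained in the core -/
  ea4 : ∀ e : E, (∀ x ∈ core B H, ⁅e, x⁆ = 0) → e ∈ core B H
  /-- (EA5): the subgroup of `(H*,+)` generated by `Ψ⁰` is free abelian of finite rank -/
  ea5 : ∃ n : ℕ, Nonempty ((AddSubgroup.closure (isoRootSet B H)) ≃+ (Fin n → ℤ))

end EALA

namespace IsEALA

open LieModule

variable {k E : Type*} [Field k] [LieRing E] [LieAlgebra k E]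
variable {B : E →ₗ[k] E →ₗ[k] k} {H : LieSubalgebra k E}
variable {α β δ : Module.Dual k H} {x y : E} {t s : H}

theorem lie_mem_wtSpace (hx : x ∈ wtSpace H α) (hy : y ∈ wtSpace H β) :
    ⁅x, y⁆ ∈ wtSpace H (α + β) := by
  intro h
  rw [leibniz_lie, hx h, hy h, smul_lie, lie_smul, LinearMap.add_apply, add_smul]

theorem pow_toEnd_mem_wtSpace (hx : x ∈ wtSpace H α) (hy : y ∈ wtSpace H β) (n : ℕ) :
    (toEnd k E E x ^ n) y ∈ wtSpace H (β + n • α) := by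
  induction n with
  | zero => simpa using hy
  | succ n ih =>
    rw [pow_succ', Module.End.mul_apply, toEnd_apply_apply, succ_nsmul,
      show β + (n • α + α) = α + (β + n • α) by abel]
    exact lie_mem_wtSpace hx ih

theorem mem_rootSet_of_mem_wtSpace (hx : x ∈ wtSpace H α) (hx0 : x ≠ 0) : α ∈ rootSet H :=
  fun h => hx0 <| by simpa [h] using hx

theorem exists_mem_wtSpace_ne_zero (hα : α ∈ rootSet H) : ∃ x ∈ wtSpace H α, x ≠ 0 :=
  Submodule.exists_mem_ne_zero_of_ne_bot hα

theorem add_mem_reps (ht : t ∈ reps B H α) (hs : s ∈ reps B H β) :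
    t + s ∈ reps B H (α + β) := by
  intro h
  simp [ht h, hs h]

theorem smul_mem_reps (c : k) (ht : t ∈ reps B H α) : c • t ∈ reps B H (c • α) := by
  intro h
  simp [ht h]

theorem neg_mem_reps (ht : t ∈ reps B H α) : -t ∈ reps B H (-α) := by
  intro h
  simp [ht h]

theorem exists_mem_reps (h : IsEALA B H) (α : Module.Dual k H) : ∃ t, t ∈ reps B H α := by
  have := h.H_fd
  let f : H →ₗ[k] Module.Dual k H := B.compl₁₂ H.toSubmodule.subtype H.toSubmodule.subtype
  have hf : Function.Injective f := by
    rw [injective_iff_map_eq_zero]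
    exact fun t ht => h.H_nondeg t fun s => LinearMap.congr_fun ht s
  obtain ⟨t, ht⟩ := (LinearMap.injective_iff_surjective_of_finrank_eq_finrank
    Subspace.dual_finrank_eq.symm).1 hf α
  exact ⟨t, fun s => LinearMap.congr_fun ht s⟩

theorem apply_comm (h : IsEALA B H) (ht : t ∈ reps B H α) (hs : s ∈ reps B H β) :
    α s = β t := by
  rw [← ht s, ← hs t, h.symm]

theorem mem_anisoRootSet_iff (ht : t ∈ reps B H α) (h : IsEALA B H) :
    α ∈ anisoRootSet B H ↔ α ∈ rootSet H ∧ α t ≠ 0 := by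
  refine ⟨fun ⟨hα, s, hs, hs0⟩ => ⟨hα, ?_⟩, fun ⟨hα, h0⟩ => ⟨hα, t, ht, by rwa [ht t]⟩⟩
  rwa [hs s, h.apply_comm ht hs] at hs0

theorem form_eq_zero (h : IsEALA B H) (hx : x ∈ wtSpace H α) (hy : y ∈ wtSpace H β)
    (hαβ : α + β ≠ 0) : B x y = 0 := by
  by_contra hxy
  refine hαβ (LinearMap.ext fun t => ?_)
  have h₁ := h.invariant x t y
  rw [hy t, ← lie_skew, hx t] at h₁
  have h₂ : (α t + β t) * B x y = 0 := by
    simp only [map_neg, map_smul, LinearMap.neg_apply, LinearMap.smul_apply, smul_eq_mul] at h₁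
    linear_combination -h₁
  simpa [hxy] using h₂

theorem exists_form_eq_one (h : IsEALA B H) (hx : x ∈ wtSpace H α) (hx0 : x ≠ 0) :
    ∃ y ∈ wtSpace H (-α), B x y = 1 := by
  by_contra! hc
  refine hx0 (h.nondeg x fun y => ?_)
  have hy : y ∈ ⨆ β, wtSpace H β := h.toral ▸ Submodule.mem_top
  refine Submodule.iSup_induction _ (motive := fun y => B x y = 0) hy ?_ (by simp)
    fun y z hy hz => by simp [hy, hz]
  intro β y hy
  by_cases hβ : α + β = 0
  · obtain rfl := eq_neg_of_add_eq_zero_right hβ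
    by_contra hxy
    refine hc ((B x y)⁻¹ • y) (Submodule.smul_mem _ _ hy) ?_
    simp [hxy]
  · exact h.form_eq_zero hx hy hβ

theorem lie_eq_form_smul (h : IsEALA B H) (ht : t ∈ reps B H α) (hx : x ∈ wtSpace H α)
    (hy : y ∈ wtSpace H (-α)) : ⁅x, y⁆ = B x y • (t : E) := by
  have hxy : ⁅x, y⁆ ∈ H := by
    rw [← LieSubalgebra.mem_toSubmodule, ← h.self_centralizing]
    simpa using lie_mem_wtSpace hx hy
  have h0 := h.H_nondeg (⟨_, hxy⟩ - B x y • t) fun s => by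
    have hys : ⁅y, (s : E)⁆ = α s • y := by
      rw [← lie_skew, hy s]
      simp
    simp [h.invariant, hys, ht s, mul_comm]
  simpa using congrArg (H.incl) (sub_eq_zero.1 h0)

theorem exists_lie_eq (h : IsEALA B H) (ht : t ∈ reps B H α) (hx : x ∈ wtSpace H α)
    (hx0 : x ≠ 0) : ∃ y ∈ wtSpace H (-α), ⁅x, y⁆ = t := by
  obtain ⟨y, hy, hxy⟩ := h.exists_form_eq_one hx hx0
  exact ⟨y, hy, by simp [h.lie_eq_form_smul ht hx hy, hxy]⟩

theorem neg_mem_rootSet (h : IsEALA B H) (hα : α ∈ rootSet H) : -α ∈ rootSet H := by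
  obtain ⟨x, hx, hx0⟩ := exists_mem_wtSpace_ne_zero hα
  obtain ⟨y, hy, hxy⟩ := h.exists_form_eq_one hx hx0
  exact mem_rootSet_of_mem_wtSpace hy fun hy0 => by simp [hy0] at hxy

theorem exists_pow_ne_zero_and_pow_succ_eq_zero {V : Type*} [AddCommGroup V] [Module k V]
    (f : Module.End k V) {v : V} (hv : v ≠ 0) {N : ℕ} (hN : (f ^ N) v = 0) :
    ∃ n, n < N ∧ (f ^ n) v ≠ 0 ∧ (f ^ (n + 1)) v = 0 := by
  induction N with
  | zero => exact absurd hN hv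
  | succ N ih =>
    by_cases hN' : (f ^ N) v = 0
    · obtain ⟨n, hn, hn'⟩ := ih hN'
      exact ⟨n, hn.trans N.lt_succ_self, hn'⟩
    · exact ⟨N, N.lt_succ_self, hN', hN⟩

/-- The Cartan number `2 (δ|β) / (β|β)` of a root `δ` and an anisotropic root `β` is an
integer. -/
theorem exists_int_cartan [CharZero k] (h : IsEALA B H) (ht : t ∈ reps B H β) (hβ : β ∈ rootSet H)
    (hβt : β t ≠ 0) (hδ : δ ∈ rootSet H) : ∃ m : ℤ, 2 * δ t = m * β t := by
  obtain ⟨e, he, he0⟩ := exists_mem_wtSpace_ne_zero hβ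
  obtain ⟨f', hf', hef'⟩ := h.exists_lie_eq ht he he0
  obtain ⟨v, hv, hv0⟩ := exists_mem_wtSpace_ne_zero hδ
  set c : k := 2 / β t with hc
  have hcβ : c * β t = 2 := div_mul_cancel₀ _ hβt
  have hc0 : c ≠ 0 := div_ne_zero two_ne_zero hβt
  have ht0 : (t : E) ≠ 0 := fun h0 => hβt <| by
    rw [show t = 0 from Subtype.ext h0, map_zero]
  have hf : c • f' ∈ wtSpace H (-β) := Submodule.smul_mem _ _ hf'
  have hsl : IsSl2Triple (c • (t : E)) e (c • f') :=
    { h_ne_zero := smul_ne_zero hc0 ht0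
      lie_e_f := by rw [lie_smul, hef']
      lie_h_e_nsmul := by
        rw [smul_lie, he t, smul_smul, hcβ, two_smul, two_nsmul]
      lie_h_f_nsmul := by
        rw [smul_lie, hf t, smul_smul, LinearMap.neg_apply, mul_neg, hcβ, neg_smul, two_smul,
          two_nsmul] }
  have hβan : β ∈ anisoRootSet B H := (mem_anisoRootSet_iff ht h).2 ⟨hβ, hβt⟩
  have htn : -t ∈ reps B H (-β) := neg_mem_reps ht
  have hβan' : -β ∈ anisoRootSet B H :=
    (mem_anisoRootSet_iff htn h).2 ⟨h.neg_mem_rootSet hβ, by simpa using hβt⟩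
  obtain ⟨N, hN⟩ := h.ea2 β hβan e he v
  obtain ⟨a, -, ha, ha'⟩ := exists_pow_ne_zero_and_pow_succ_eq_zero (toEnd k E E e) hv0
    (N := N) (by rw [Module.End.pow_apply]; exact hN)
  have hw := pow_toEnd_mem_wtSpace he hv a
  have P : hsl.HasPrimitiveVectorWith ((toEnd k E E e ^ a) v) (c * (δ t + a * β t)) :=
    { ne_zero := ha
      lie_h := by rw [smul_lie, hw t, smul_smul]; simp
      lie_e := by rwa [pow_succ', Module.End.mul_apply, toEnd_apply_apply] at ha' }
  obtain ⟨M, hM⟩ := h.ea2 (-β) hβan' _ hf ((toEnd k E E e ^ a) v)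
  obtain ⟨b, -, hb, hb'⟩ := exists_pow_ne_zero_and_pow_succ_eq_zero (toEnd k E E (c • f')) ha
    (N := M) (by rw [Module.End.pow_apply]; exact hM)
  have key := P.lie_e_pow_succ_toEnd_f b
  rw [hb', lie_zero, eq_comm, smul_eq_zero_iff_left hb, mul_eq_zero, sub_eq_zero] at key
  replace key := key.resolve_left (Nat.cast_add_one_ne_zero b)
  refine ⟨b - 2 * a, ?_⟩
  push_cast
  linear_combination (β t) * key - (δ t + a * β t) * hcβ

/-- If a root `δ` is isotropic and not orthogonal to `β`, then the root string of `β` through `δ`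
is unbounded in at least one direction. -/
theorem add_smul_mem_rootSet_or [CharZero k] (h : IsEALA B H) (ht : t ∈ reps B H δ) (hδ : δ ∈ rootSet H)
    (hδt : δ t = 0) (hβ : β ∈ rootSet H) (hβt : β t ≠ 0) (N : ℕ) :
    β + N • δ ∈ rootSet H ∨ β + N • (-δ) ∈ rootSet H := by
  obtain ⟨x, hx, hx0⟩ := exists_mem_wtSpace_ne_zero hδ
  obtain ⟨y, hy, hxy⟩ := h.exists_lie_eq ht hx hx0
  obtain ⟨v, hv, hv0⟩ := exists_mem_wtSpace_ne_zero hβ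
  by_cases hN : (toEnd k E E x ^ N) v = 0
  swap
  · exact .inl (mem_rootSet_of_mem_wtSpace (pow_toEnd_mem_wtSpace hx hv N) hN)
  right
  obtain ⟨a, haN, ha, ha'⟩ := exists_pow_ne_zero_and_pow_succ_eq_zero _ hv0 hN
  have hwt := pow_toEnd_mem_wtSpace hx hv a
  have hxw : ⁅x, (toEnd k E E x ^ a) v⁆ = 0 := by
    rwa [pow_succ', Module.End.mul_apply, toEnd_apply_apply] at ha'
  generalize (toEnd k E E x ^ a) v = w at ha hwt hxw
  have hxy_pow (n : ℕ) : ⁅x, (toEnd k E E y ^ (n + 1)) w⁆ =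
      ((n + 1) * β t) • (toEnd k E E y ^ n) w := by
    have htn := pow_toEnd_mem_wtSpace hy hwt n t
    induction n with
    | zero =>
      simp only [zero_add, pow_one, toEnd_apply_apply, leibniz_lie x y, hxy, hxw, lie_zero, hwt t]
      simp [hδt]
    | succ n ih =>
      rw [pow_succ', Module.End.mul_apply, toEnd_apply_apply, leibniz_lie x y, hxy, htn,
        ih (pow_toEnd_mem_wtSpace hy hwt n t), lie_smul, ← toEnd_apply_apply k E E y,
        ← Module.End.mul_apply, ← pow_succ', ← add_smul]
      congr 1
      simp [hδt]
      ring
  have hne (n : ℕ) : (toEnd k E E y ^ n) w ≠ 0 := by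
    induction n with
    | zero => simpa using ha
    | succ n ih =>
      intro h0
      have := hxy_pow n
      rw [h0, lie_zero, eq_comm, smul_eq_zero_iff_left ih] at this
      exact mul_ne_zero (Nat.cast_add_one_ne_zero n) hβt this
  have hroot := mem_rootSet_of_mem_wtSpace (pow_toEnd_mem_wtSpace hy hwt (a + N)) (hne _)
  rwa [show β + a • δ + (a + N) • (-δ) = β + N • (-δ) by rw [add_nsmul, smul_neg]; abel] at hroot

theorem add_smul_notMem_rootSet [CharZero k] (h : IsEALA B H) (ht : t ∈ reps B H α) (hs : s ∈ reps B H δ)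
    (hα : α ∈ rootSet H) (hαt : α t ≠ 0) (hδ : δ ∈ rootSet H) (hδs : δ s = 0)
    (hαs : α s ≠ 0) : α + 3 • δ ∉ rootSet H := by
  intro hroot
  have hcomm := h.apply_comm ht hs
  have hts := add_mem_reps ht (smul_mem_reps (3 : k) hs)
  rw [ofNat_smul_eq_nsmul] at hts
  obtain ⟨m, hm⟩ := h.exists_int_cartan ht hα hαt hδ
  have hm0 : m ≠ 0 := by
    rintro rfl
    simp [← hcomm, hαs] at hm
  have hval : (α + 3 • δ) (t + (3 : k) • s) = α t + 6 * α s := by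
    simp [hδs, ← hcomm]
    ring
  rw [← hcomm] at hm
  by_cases h0 : α t + 6 * α s = 0
  · have : ((1 + 3 * m : ℤ) : k) * α s = 0 := by
      push_cast
      linear_combination (1 / 2 : k) * hm + (m / 2 : k) * h0
    rw [mul_eq_zero, Int.cast_eq_zero] at this
    have := this.resolve_right hαs
    omega
  · obtain ⟨n, hn⟩ := h.exists_int_cartan hts hroot (by rwa [hval]) hδ
    rw [hval, map_add, map_smul, hδs, ← hcomm, smul_zero, add_zero] at hn
    have : ((m - n * (1 + 3 * m) : ℤ) : k) * α s = 0 := by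
      push_cast
      linear_combination (m / 2 : k) * hn - (n / 2 : k) * hm
    rw [mul_eq_zero, Int.cast_eq_zero] at this
    have hdvd : 1 + 3 * m ∣ m := ⟨n, by linarith [this.resolve_right hαs]⟩
    have := Int.natAbs_le_of_dvd_ne_zero hdvd hm0
    omega

/-- Isotropic roots are orthogonal to anisotropic roots. -/
theorem apply_eq_zero_of_isotropic [CharZero k] (h : IsEALA B H) (ht : t ∈ reps B H α)
    (hs : s ∈ reps B H δ) (hα : α ∈ rootSet H) (hαt : α t ≠ 0) (hδ : δ ∈ rootSet H)
    (hδs : δ s = 0) : α s = 0 := by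
  by_contra hαs
  have hsn : -s ∈ reps B H (-δ) := neg_mem_reps hs
  rcases h.add_smul_mem_rootSet_or hs hδ hδs hα hαs 3 with hroot | hroot
  · exact h.add_smul_notMem_rootSet ht hs hα hαt hδ hδs hαs hroot
  · exact h.add_smul_notMem_rootSet ht hsn hα hαt (h.neg_mem_rootSet hδ) (by simpa using hδs)
      (by simpa using hαs) hroot

/-- If `δ` is isotropic and orthogonal to `α`, which is not isotropic, then `δ + α` is an
anisotropic root as soon as it is a root. -/
theorem add_mem_anisoRootSet (h : IsEALA B H) (ht : t ∈ reps B H α) (hs : s ∈ reps B H δ)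
    (hαt : α t ≠ 0) (hαs : α s = 0) (hδs : δ s = 0) (hroot : δ + α ∈ rootSet H) :
    δ + α ∈ anisoRootSet B H := by
  refine (mem_anisoRootSet_iff (add_mem_reps hs ht) h).2 ⟨hroot, ?_⟩
  simpa [hαs, hδs, ← h.apply_comm ht hs] using hαt

theorem mem_core (hα : α ∈ anisoRootSet B H) (hx : x ∈ wtSpace H α) : x ∈ core B H :=
  LieSubalgebra.subset_lieSpan (Set.mem_biUnion hα hx)

theorem lie_mem_core [CharZero k] (h : IsEALA B H) (z : E) (hx : x ∈ core B H) :
    ⁅z, x⁆ ∈ core B H := by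
  have hz : z ∈ ⨆ β, wtSpace H β := h.toral ▸ Submodule.mem_top
  refine Submodule.iSup_induction _ (motive := fun z => ⁅z, x⁆ ∈ core B H) hz ?_ (by simp)
    fun y z hy hz => by
      rw [add_lie]
      exact add_mem hy hz
  intro δ z hz
  by_cases hz0 : z = 0
  · simp [hz0]
  have hδ := mem_rootSet_of_mem_wtSpace hz hz0
  obtain ⟨s, hs⟩ := h.exists_mem_reps δ
  by_cases hδs : δ s = 0
  swap
  · exact (core B H).lie_mem (mem_core ((mem_anisoRootSet_iff hs h).2 ⟨hδ, hδs⟩) hz) hx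
  induction hx using LieSubalgebra.lieSpan_induction with
  | mem x hx =>
    simp only [Set.mem_iUnion] at hx
    obtain ⟨α, hα, hx⟩ := hx
    obtain ⟨t, ht⟩ := h.exists_mem_reps α
    obtain ⟨hαr, hαt⟩ := (mem_anisoRootSet_iff ht h).1 hα
    have hzx := lie_mem_wtSpace hz hx
    by_cases hzx0 : ⁅z, x⁆ = 0
    · simp [hzx0]
    · exact mem_core (h.add_mem_anisoRootSet ht hs hαt
        (h.apply_eq_zero_of_isotropic ht hs hαr hαt hδ hδs) hδs
        (mem_rootSet_of_mem_wtSpace hzx hzx0)) hzx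
  | zero => simp
  | add x y _ _ hx hy =>
    rw [lie_add]
    exact add_mem hx hy
  | smul a x _ hx =>
    rw [lie_smul]
    exact (core B H).smul_mem a hx
  | lie x y hx' hy' hx hy =>
    rw [leibniz_lie]
    exact add_mem ((core B H).lie_mem hx hy') ((core B H).lie_mem hx' hy)

/-- A subspace stable under `H` contains the weight components of its elements. -/
theorem mem_of_sum_mem (I : Submodule k E) (hI : ∀ t : H, ∀ x ∈ I, ⁅(t : E), x⁆ ∈ I)
    (S : Finset (Module.Dual k H)) (v : Module.Dual k H → E) (hv : ∀ α, v α ∈ wtSpace H α)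
    (hsum : ∑ α ∈ S, v α ∈ I) (β : Module.Dual k H) (hβ : β ∈ S) : v β ∈ I := by
  classical
  induction S using Finset.induction_on generalizing v β with
  | empty => simp at hβ
  | insert a S ha ih =>
    have hS : ∀ β ∈ S, v β ∈ I := by
      intro β hβ
      obtain ⟨t, ht⟩ : ∃ t, β t ≠ a t := by
        by_contra! hc
        exact ha ((LinearMap.ext hc : β = a) ▸ hβ)
      have hsub := I.sub_mem (hI t _ hsum) (I.smul_mem (a t) hsum)
      have heq : ⁅(t : E), ∑ γ ∈ insert a S, v γ⁆ - a t • ∑ γ ∈ insert a S, v γ =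
          ∑ γ ∈ S, (γ t - a t) • v γ := by
        have hlie : ⁅(t : E), ∑ γ ∈ insert a S, v γ⁆ = ∑ γ ∈ insert a S, γ t • v γ := by
          rw [lie_sum]
          exact Finset.sum_congr rfl fun γ _ => hv γ t
        rw [hlie, Finset.smul_sum, ← Finset.sum_sub_distrib, Finset.sum_insert ha]
        simp [sub_smul]
      rw [heq] at hsub
      have := ih (fun γ => (γ t - a t) • v γ) (fun γ => Submodule.smul_mem _ _ (hv γ)) hsub β hβ
      exact (I.smul_mem_iff (sub_ne_zero.2 ht)).1 this
    rcases Finset.mem_insert.1 hβ with rfl | hβ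
    · rw [Finset.sum_insert ha] at hsum
      exact (I.add_mem_iff_left (I.sum_mem hS)).1 hsum
    · exact hS β hβ

/-- An ideal meeting a root space contains all anisotropic root spaces whose root is not
orthogonal to the given one. -/
theorem wtSpace_le_of_mem_ideal (h : IsEALA B H) (I : Submodule k E)
    (hI : ∀ z : E, ∀ x ∈ I, ⁅z, x⁆ ∈ I) (hs : s ∈ reps B H δ) (hx : x ∈ wtSpace H δ)
    (hxI : x ∈ I) (hx0 : x ≠ 0) (hαs : α s ≠ 0) : wtSpace H α ≤ I := by
  intro e he
  obtain ⟨y, hy, hxy⟩ := h.exists_lie_eq hs hx hx0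
  have hsI : (s : E) ∈ I := by
    rw [← hxy, ← lie_skew]
    exact I.neg_mem (hI _ _ hxI)
  rw [← I.smul_mem_iff hαs, ← he s, ← lie_skew]
  exact I.neg_mem (hI _ _ hsI)

/-- An ideal which contains some nonzero anisotropic root vector contains the core. -/
theorem core_le_of_mem_ideal (h : IsEALA B H) (I : LieSubalgebra k E)
    (hI : ∀ z : E, ∀ x ∈ I, ⁅z, x⁆ ∈ I) (hα : α ∈ anisoRootSet B H) (hx : x ∈ wtSpace H α)
    (hxI : x ∈ I) (hx0 : x ≠ 0) : core B H ≤ I := by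
  suffices hall : ∀ β ∈ anisoRootSet B H, wtSpace H β ≤ I.toSubmodule from
    LieSubalgebra.lieSpan_le.2 (Set.iUnion₂_subset hall)
  by_contra! hc
  obtain ⟨β, hβ, hβI⟩ := hc
  have hαI : wtSpace H α ≤ I.toSubmodule := by
    obtain ⟨t, ht⟩ := h.exists_mem_reps α
    exact h.wtSpace_le_of_mem_ideal I.toSubmodule hI ht hx hxI hx0
      ((mem_anisoRootSet_iff ht h).1 hα).2
  obtain ⟨γ, hγ, η, hη, t, ht, s, hs, hts⟩ := h.ea3
    {γ | γ ∈ anisoRootSet B H ∧ wtSpace H γ ≤ I.toSubmodule}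
    {γ | γ ∈ anisoRootSet B H ∧ ¬ wtSpace H γ ≤ I.toSubmodule}
    (by
      ext γ
      by_cases hγ : wtSpace H γ ≤ I.toSubmodule <;> simp [hγ])
    ⟨α, hα, hαI⟩ ⟨β, hβ, hβI⟩
  obtain ⟨v, hv, hv0⟩ := exists_mem_wtSpace_ne_zero hγ.1.1
  exact hη.2 (h.wtSpace_le_of_mem_ideal I.toSubmodule hI ht hv (hγ.2 hv) hv0
    (by rwa [← hs t, h.symm]))

/-- An ideal either contains the core or centralizes it. -/
theorem core_le_or_lie_eq_zero (h : IsEALA B H) (I : LieSubalgebra k E)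
    (hI : ∀ z : E, ∀ x ∈ I, ⁅z, x⁆ ∈ I) :
    core B H ≤ I ∨ ∀ z ∈ I, ∀ x ∈ core B H, ⁅z, x⁆ = 0 := by
  rw [or_iff_not_imp_left]
  intro hle
  have hzero {α : Module.Dual k H} (hα : α ∈ anisoRootSet B H) {x : E}
      (hx : x ∈ wtSpace H α) (hxI : x ∈ I) : x = 0 := by
    by_contra hx0
    exact hle (h.core_le_of_mem_ideal I hI hα hx hxI hx0)
  have hhom (δ : Module.Dual k H) (z : E) (hz : z ∈ wtSpace H δ) (hzI : z ∈ I)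
      (α : Module.Dual k H) (hα : α ∈ anisoRootSet B H) (x : E) (hx : x ∈ wtSpace H α) :
      ⁅z, x⁆ = 0 := by
    by_contra hzx
    have hz0 : z ≠ 0 := fun hz0 => hzx (by simp [hz0])
    have hδ := mem_rootSet_of_mem_wtSpace hz hz0
    obtain ⟨s, hs⟩ := h.exists_mem_reps δ
    obtain ⟨t, ht⟩ := h.exists_mem_reps α
    have hδs : δ s = 0 := by
      by_contra hδs
      exact hz0 (hzero ((mem_anisoRootSet_iff hs h).2 ⟨hδ, hδs⟩) hz hzI)
    have hαs : α s = 0 := by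
      by_contra hαs
      obtain ⟨v, hv, hv0⟩ := exists_mem_wtSpace_ne_zero hα.1
      exact hv0 (hzero hα hv (h.wtSpace_le_of_mem_ideal I.toSubmodule hI hs hz hzI hz0 hαs hv))
    have hmem := lie_mem_wtSpace hz hx
    have hzxI : ⁅z, x⁆ ∈ I := by
      rw [← lie_skew]
      exact neg_mem (hI _ _ hzI)
    exact hzx (hzero (h.add_mem_anisoRootSet ht hs ((mem_anisoRootSet_iff ht h).1 hα).2 hαs hδs
      (mem_rootSet_of_mem_wtSpace hmem hzx)) hmem hzxI)
  intro z hz x hx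
  induction hx using LieSubalgebra.lieSpan_induction with
  | mem x hx =>
    simp only [Set.mem_iUnion] at hx
    obtain ⟨α, hα, hx⟩ := hx
    have hz' : z ∈ ⨆ β, wtSpace H β := h.toral ▸ Submodule.mem_top
    obtain ⟨v, hv, rfl⟩ := (Submodule.mem_iSup_iff_exists_finsupp _ _).1 hz'
    have hvI := mem_of_sum_mem I.toSubmodule (fun t => hI t) v.support v hv hz
    rw [Finsupp.sum, sum_lie]
    exact Finset.sum_eq_zero fun δ hδ => hhom δ _ (hv δ) (hvI δ hδ) α hα x hx
  | zero => simp
  | add x y _ _ hx hy => rw [lie_add, hx, hy, add_zero]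
  | smul a x _ hx => rw [lie_smul, hx, smul_zero]
  | lie x y _ _ hx hy => rw [leibniz_lie, hx, hy, zero_lie, lie_zero, add_zero]

theorem anisoRootSet_nonempty (h : IsEALA B H) : (anisoRootSet B H).Nonempty := by
  by_contra hne
  have hcore : core B H = ⊥ := by
    simp [core, Set.not_nonempty_iff_eq_empty.1 hne]
  refine h.H_ne_bot ((LieSubalgebra.eq_bot_iff _).2 fun x _ => ?_)
  have := h.ea4 x fun y hy => by
    rw [hcore, LieSubalgebra.mem_bot] at hy
    simp [hy]
  rwa [hcore, LieSubalgebra.mem_bot] at this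

theorem exists_lie_ne_zero [CharZero k] (h : IsEALA B H) :
    ∃ x ∈ core B H, ∃ y ∈ core B H, ⁅x, y⁆ ≠ 0 := by
  obtain ⟨α, hα⟩ := h.anisoRootSet_nonempty
  obtain ⟨t, ht⟩ := h.exists_mem_reps α
  obtain ⟨hαr, hαt⟩ := (mem_anisoRootSet_iff ht h).1 hα
  obtain ⟨x, hx, hx0⟩ := exists_mem_wtSpace_ne_zero hαr
  obtain ⟨y, hy, hxy⟩ := h.exists_lie_eq ht hx hx0
  have hxc := mem_core hα hx
  refine ⟨⁅y, x⁆, h.lie_mem_core y hxc, x, hxc, ?_⟩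
  rw [← lie_skew y x, hxy, neg_lie, hx t]
  exact neg_ne_zero.2 (smul_ne_zero hαt hx0)

theorem core_le_core [CharZero k] (h : IsEALA B H) {B' : E →ₗ[k] E →ₗ[k] k} {H' : LieSubalgebra k E}
    (h' : IsEALA B' H') : core B H ≤ core B' H' := by
  refine (h.core_le_or_lie_eq_zero (core B' H') fun z _ => h'.lie_mem_core z).resolve_right ?_
  intro hc
  obtain ⟨x, hx, y, hy, hxy⟩ := h'.exists_lie_ne_zero
  exact hxy (hc x hx y (h.ea4 y (hc y hy)))

end IsEALA

/-- Corollary 3.2 of the paper: two EALA structures `(E,H,(·|·))` and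
`(E,H',(·|·)')` on the same Lie algebra `E` have the same core: `E_c = E'_c`. -/
theorem eala_cores_are_equal
    {k E : Type*} [Field k] [CharZero k] [LieRing E] [LieAlgebra k E]
    (B : E →ₗ[k] E →ₗ[k] k) (H : LieSubalgebra k E) (h : IsEALA B H)
    (B' : E →ₗ[k] E →ₗ[k] k) (H' : LieSubalgebra k E) (h' : IsEALA B' H') :
    core B H = core B' H' := by
  exact le_antisymm (h.core_le_core h') (h'.core_le_core h)
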